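/- arXiv:2308.10534 — 6 statements merged into one kernel-verified Lean document; each statement's English description precedes it below -/
import Mathlib

section
/- Let Θ ⊆ ℝᵏ and let C* : Θ → 2^{ℝⁿ} be a correspondence such that, for every θ ∈ Θ, C*(θ) is nonempty, closed and convex, and such that C* is lower hemicontinuous on Θ, i.e. for every θ₀ ∈ Θ and ε > 0 there exists δ > 0 such that C*(θ₀) ⊆ B_ε(C*(θ)) for all θ ∈ Θ with ‖θ − θ₀‖ < δ. Then C* admits a continuous selection: there exists a continuous function g : Θ → ℝⁿ with g(θ) ∈ C*(θ) for all θ ∈ Θ. -/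
open Filter Topology Metric

section MichaelSelection

variable {X E : Type*} [TopologicalSpace X] [NormalSpace X] [ParacompactSpace X]
  [NormedAddCommGroup E] [NormedSpace ℝ E] {C : X → Set E}

/-- A lower hemicontinuous correspondence with nonempty convex values has continuous
`ε`-approximate selections. -/
theorem LowerHemicontinuous.exists_continuous_mem_thickening (hC : LowerHemicontinuous C)
    (hne : ∀ x, (C x).Nonempty) (hcv : ∀ x, Convex ℝ (C x)) {ε : ℝ} (hε : 0 < ε) :
    ∃ g : C(X, E), ∀ x, g x ∈ thickening ε (C x) := by
  refine exists_continuous_forall_mem_convex_of_local_const (fun x => (hcv x).thickening ε)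
    fun x => ?_
  obtain ⟨c, hc⟩ := hne x
  refine ⟨c, ?_⟩
  filter_upwards [lowerHemicontinuousAt_iff.1 (hC x) (ball c ε) isOpen_ball
    ⟨c, hc, mem_ball_self hε⟩] with y hy
  obtain ⟨z, hz, hzc⟩ := hy
  exact mem_thickening_iff.2 ⟨z, hz, mem_ball'.1 hzc⟩

/-- A continuous `r`-approximate selection can be refined to a continuous `ε`-approximate
selection at distance less than `r` from it. -/
theorem LowerHemicontinuous.exists_continuous_mem_thickening_dist_lt
    (hC : LowerHemicontinuous C) (hcv : ∀ x, Convex ℝ (C x)) {r ε : ℝ} (hε : 0 < ε)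
    (f : C(X, E)) (hf : ∀ x, f x ∈ thickening r (C x)) :
    ∃ g : C(X, E), (∀ x, g x ∈ thickening ε (C x)) ∧ ∀ x, dist (f x) (g x) < r := by
  obtain ⟨g, hg⟩ : ∃ g : C(X, E), ∀ x, g x ∈ thickening ε (C x) ∩ ball (f x) r := by
    refine exists_continuous_forall_mem_convex_of_local_const
      (fun x => ((hcv x).thickening ε).inter (convex_ball _ _)) fun x => ?_
    obtain ⟨c, hc, hcf⟩ := mem_thickening_iff.1 (hf x)
    refine ⟨c, ?_⟩
    have hnear : ∀ᶠ y in 𝓝 x, dist (f y) c < r :=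
      (f.continuous.dist continuous_const).continuousAt.eventually_lt_const hcf
    filter_upwards [lowerHemicontinuousAt_iff.1 (hC x) (ball c ε) isOpen_ball
      ⟨c, hc, mem_ball_self hε⟩, hnear] with y hy hyc
    obtain ⟨z, hz, hzc⟩ := hy
    exact ⟨mem_thickening_iff.2 ⟨z, hz, mem_ball'.1 hzc⟩, mem_ball'.2 hyc⟩
  exact ⟨g, fun x => (hg x).1, fun x => mem_ball'.1 (hg x).2⟩

/-- **Michael selection theorem**: a lower hemicontinuous correspondence from a paracompact normal
space to a Banach space, with nonempty closed convex values, has a continuous selection. -/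
theorem LowerHemicontinuous.exists_continuous_selection [CompleteSpace E]
    (hC : LowerHemicontinuous C) (hne : ∀ x, (C x).Nonempty) (hcl : ∀ x, IsClosed (C x))
    (hcv : ∀ x, Convex ℝ (C x)) : ∃ g : C(X, E), ∀ x, g x ∈ C x := by
  let A (m : ℕ) : Type _ := {f : C(X, E) // ∀ x, f x ∈ thickening ((1 / 2 : ℝ) ^ m) (C x)}
  have hstep (m : ℕ) (f : A m) :
      ∃ g : A (m + 1), ∀ x, dist (f.1 x) (g.1 x) < (1 / 2 : ℝ) ^ m := by
    obtain ⟨g, hg, hfg⟩ := hC.exists_continuous_mem_thickening_dist_lt hcv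
      (ε := (1 / 2 : ℝ) ^ (m + 1)) (by positivity) f.1 f.2
    exact ⟨⟨g, hg⟩, hfg⟩
  choose next hnext using hstep
  obtain ⟨f₀, hf₀⟩ := hC.exists_continuous_mem_thickening hne hcv
    (ε := (1 / 2 : ℝ) ^ 0) (by positivity)
  let F (m : ℕ) : A m := Nat.rec ⟨f₀, hf₀⟩ next m
  have hF (x : X) (m : ℕ) : dist ((F m).1 x) ((F (m + 1)).1 x) ≤ 1 * (1 / 2 : ℝ) ^ m := by
    rw [one_mul]
    exact (hnext m (F m) x).le
  have hlim (x : X) : ∃ l, Tendsto (fun m => (F m).1 x) atTop (𝓝 l) :=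
    cauchySeq_tendsto_of_complete (cauchySeq_of_le_geometric _ _ (by norm_num) (hF x))
  choose g hg using hlim
  have hpow : Tendsto (fun m : ℕ => (1 / 2 : ℝ) ^ m) atTop (𝓝 0) :=
    tendsto_pow_atTop_nhds_zero_of_lt_one (by norm_num) (by norm_num)
  have hunif : TendstoUniformly (fun m x => (F m).1 x) g atTop := by
    refine Metric.tendstoUniformly_iff.2 fun ε hε => ?_
    filter_upwards [hpow.eventually_lt_const (half_pos hε)] with m hm x
    have := dist_le_of_le_geometric_of_tendsto _ _ (by norm_num) (hF x) (hg x) m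
    rw [dist_comm]
    refine this.trans_lt ?_
    rw [div_lt_iff₀ (by norm_num)]
    linarith
  refine ⟨⟨g, hunif.continuous (Frequently.of_forall fun m => (F m).1.continuous)⟩, fun x => ?_⟩
  rw [ContinuousMap.coe_mk, (hcl x).mem_iff_infDist_zero (hne x)]
  refine le_antisymm ?_ infDist_nonneg
  exact le_of_tendsto_of_tendsto' (((continuous_infDist_pt (C x)).tendsto (g x)).comp (hg x)) hpow
    fun m => ((mem_thickening_iff_infDist_lt (hne x)).1 ((F m).2 x)).le

end MichaelSelection


/-- Michael selection: a nonempty, closed, convex valued and lower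
hemicontinuous correspondence `Cstar` on `Θ ⊆ ℝᵏ` admits a continuous selection. -/
theorem stmt_1 {k n : ℕ} (Θ : Set (EuclideanSpace ℝ (Fin k)))
    (Cstar : EuclideanSpace ℝ (Fin k) → Set (EuclideanSpace ℝ (Fin n)))
    (hne : ∀ θ ∈ Θ, (Cstar θ).Nonempty)
    (hcl : ∀ θ ∈ Θ, IsClosed (Cstar θ))
    (hcv : ∀ θ ∈ Θ, Convex ℝ (Cstar θ))
    (hlhc : ∀ θ₀ ∈ Θ, ∀ ε > (0:ℝ), ∃ δ > (0:ℝ), ∀ θ ∈ Θ, ‖θ - θ₀‖ < δ →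
      Cstar θ₀ ⊆ {y | ∃ x ∈ Cstar θ, ‖x - y‖ < ε}) :
    ∃ g : EuclideanSpace ℝ (Fin k) → EuclideanSpace ℝ (Fin n),
      ContinuousOn g Θ ∧ ∀ θ ∈ Θ, g θ ∈ Cstar θ := by
  classical
  have hC : LowerHemicontinuous fun θ : Θ => Cstar θ := by
    refine fun θ₀ => lowerHemicontinuousAt_iff.2 fun u hu hne' => ?_
    obtain ⟨c, hc, hcu⟩ := hne'
    obtain ⟨ε, hε, hball⟩ := Metric.isOpen_iff.1 hu c hcu
    obtain ⟨δ, hδ, h⟩ := hlhc θ₀ θ₀.2 ε hε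
    filter_upwards [ball_mem_nhds θ₀ hδ] with θ hθ
    obtain ⟨z, hz, hzc⟩ := h θ θ.2 (by rwa [← dist_eq_norm]) hc
    exact ⟨z, hz, hball (by rwa [mem_ball, dist_eq_norm])⟩
  obtain ⟨g, hg⟩ := hC.exists_continuous_selection (fun θ => hne θ θ.2) (fun θ => hcl θ θ.2)
    fun θ => hcv θ θ.2
  refine ⟨fun θ => if h : θ ∈ Θ then g ⟨θ, h⟩ else 0, ?_, fun θ hθ => ?_⟩
  · rw [continuousOn_iff_continuous_domRestrict]
    refine g.continuous.congr fun θ => ?_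
    simp
  · simpa [hθ] using hg ⟨θ, hθ⟩
end

section
/- Let Θ ⊆ ℝᵏ, let C, C* : Θ → 2^{ℝⁿ} be correspondences, and fix θ ∈ Θ. Assume that C* is upper hemicontinuous at θ with nonempty values, and that Conv(C*(θ)) ⊆ C(θ). Then for every ε > 0 there exists δ > 0 such that: for any points θ₁, …, θ_{k+1} ∈ Θ with ‖θ − θ_l‖ < δ for all l, any weights λ₁, …, λ_{k+1} ≥ 0 with λ₁ + ⋯ + λ_{k+1} = 1, and any points x_l ∈ C*(θ_l) for l = 1, …, k+1, the convex combination x̂ = λ₁x₁ + ⋯ + λ_{k+1}x_{k+1} satisfies x̂ ∈ B_ε(C(θ)); that is, x̂ is an ε-infeasible solution. -/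
/-- if `Cstar` is upper hemicontinuous at `θ` with nonempty values and
`Conv(Cstar θ) ⊆ C θ`, then for every `ε > 0` there is `δ > 0` such that any convex
combination of optimal points sampled at parameters `δ`-close to `θ` lies in
`B_ε(C θ)`, i.e. is an `ε`-infeasible solution. -/
theorem stmt_5 {k n : ℕ} (Θ : Set (EuclideanSpace ℝ (Fin k)))
    (C Cstar : EuclideanSpace ℝ (Fin k) → Set (EuclideanSpace ℝ (Fin n)))
    (θ : EuclideanSpace ℝ (Fin k)) (hθ : θ ∈ Θ)
    (hne : ∀ θ' ∈ Θ, (Cstar θ').Nonempty)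
    (huhc : ∀ ε > (0:ℝ), ∃ δ > (0:ℝ), ∀ θ' ∈ Θ, ‖θ - θ'‖ < δ →
      Cstar θ' ⊆ {y | ∃ x ∈ Cstar θ, ‖x - y‖ < ε})
    (hconv : convexHull ℝ (Cstar θ) ⊆ C θ) :
    ∀ ε > (0:ℝ), ∃ δ > (0:ℝ),
      ∀ θl : Fin (k+1) → EuclideanSpace ℝ (Fin k),
        (∀ l, θl l ∈ Θ) → (∀ l, ‖θ - θl l‖ < δ) →
      ∀ lam : Fin (k+1) → ℝ, (∀ l, 0 ≤ lam l) → (∑ l, lam l) = 1 →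
      ∀ x : Fin (k+1) → EuclideanSpace ℝ (Fin n), (∀ l, x l ∈ Cstar (θl l)) →
        (∑ l, lam l • x l) ∈ {y | ∃ z ∈ C θ, ‖z - y‖ < ε} := by
  intro ε hε
  obtain ⟨δ, hδ, h⟩ := huhc ε hε
  refine ⟨δ, hδ, fun θl hΘ hclose lam hlam hsum x hx => ?_⟩
  have hmem : ∑ l, lam l • x l ∈ Metric.thickening ε (convexHull ℝ (Cstar θ)) := by
    refine ((convex_convexHull ℝ (Cstar θ)).thickening ε).sum_mem
      (fun l _ => hlam l) hsum fun l _ => ?_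
    obtain ⟨z, hz, hzx⟩ := h (θl l) (hΘ l) (hclose l) (hx l)
    exact Metric.mem_thickening_iff.2
      ⟨z, subset_convexHull ℝ _ hz, by rwa [dist_comm, dist_eq_norm]⟩
  obtain ⟨z, hz, hzx⟩ := Metric.mem_thickening_iff.1 hmem
  exact ⟨z, hconv hz, by rwa [← dist_eq_norm, dist_comm]⟩
end

section
/- Let Θ ⊆ ℝᵏ, let f : ℝⁿ × Θ → ℝ be continuous, let C : Θ → 2^{ℝⁿ} have nonempty compact values, define f*(θ) = min_{x ∈ C(θ)} f(x, θ) and C*(θ) = {x ∈ C(θ) : f(x, θ) = f*(θ)}, and fix θ ∈ Θ. Assume that C* is upper hemicontinuous at θ with nonempty compact values, and that f(x, θ) = f*(θ) for all x ∈ Conv(C*(θ)). Then for every ε > 0 there exists δ > 0 such that: for any points θ₁, …, θ_{k+1} ∈ Θ with ‖θ − θ_l‖ < δ for all l, any weights λ₁, …, λ_{k+1} ≥ 0 with λ₁ + ⋯ + λ_{k+1} = 1, and any x_l ∈ C*(θ_l), the convex combination x̂ = λ₁x₁ + ⋯ + λ_{k+1}x_{k+1} satisfies |f(x̂, θ) −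 f*(θ)| < ε; that is, x̂ is an ε-suboptimal solution. -/
/-- under the Maximum-Theorem setting, if the optimal policy `Cstar` is
upper hemicontinuous at `θ` with nonempty compact values, and `f(·, θ)` equals the
optimal value `fstar θ` on `Conv(Cstar θ)`, then for every `ε > 0` there is `δ > 0`
such that every convex combination of optimal points sampled at parameters `δ`-close
to `θ` is an `ε`-suboptimal solution. -/
theorem stmt_6 {k n : ℕ} (Θ : Set (EuclideanSpace ℝ (Fin k)))
    (f : EuclideanSpace ℝ (Fin n) → EuclideanSpace ℝ (Fin k) → ℝ)
    (hf : ContinuousOn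
      (fun p : EuclideanSpace ℝ (Fin n) × EuclideanSpace ℝ (Fin k) => f p.1 p.2)
      (Set.univ ×ˢ Θ))
    (C Cstar : EuclideanSpace ℝ (Fin k) → Set (EuclideanSpace ℝ (Fin n)))
    (hCne : ∀ θ' ∈ Θ, (C θ').Nonempty) (hCcpt : ∀ θ' ∈ Θ, IsCompact (C θ'))
    (fstar : EuclideanSpace ℝ (Fin k) → ℝ)
    (hfstar : ∀ θ' ∈ Θ, IsLeast ((fun x => f x θ') '' C θ') (fstar θ'))
    (hCstar : ∀ θ' ∈ Θ, Cstar θ' = {x ∈ C θ' | f x θ' = fstar θ'})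
    (θ : EuclideanSpace ℝ (Fin k)) (hθ : θ ∈ Θ)
    (hne : ∀ θ' ∈ Θ, (Cstar θ').Nonempty)
    (hcpt : ∀ θ' ∈ Θ, IsCompact (Cstar θ'))
    (huhc : ∀ ε > (0:ℝ), ∃ δ > (0:ℝ), ∀ θ' ∈ Θ, ‖θ - θ'‖ < δ →
      Cstar θ' ⊆ {y | ∃ x ∈ Cstar θ, ‖x - y‖ < ε})
    (hconst : ∀ x ∈ convexHull ℝ (Cstar θ), f x θ = fstar θ) :
    ∀ ε > (0:ℝ), ∃ δ > (0:ℝ),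
      ∀ θl : Fin (k+1) → EuclideanSpace ℝ (Fin k),
        (∀ l, θl l ∈ Θ) → (∀ l, ‖θ - θl l‖ < δ) →
      ∀ lam : Fin (k+1) → ℝ, (∀ l, 0 ≤ lam l) → (∑ l, lam l) = 1 →
      ∀ x : Fin (k+1) → EuclideanSpace ℝ (Fin n), (∀ l, x l ∈ Cstar (θl l)) →
        |f (∑ l, lam l • x l) θ - fstar θ| < ε := by
  intro ε hε
  have hg : Continuous fun x => f x θ := by
    rw [← continuousOn_univ]
    exact hf.comp (by fun_prop : ContinuousOn (fun x => (x, θ)) Set.univ)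
      fun x hx => ⟨hx, hθ⟩
  have hU : IsOpen {y | |f y θ - fstar θ| < ε} :=
    isOpen_lt (hg.sub continuous_const).abs continuous_const
  have hcpt' : IsCompact (closure (convexHull ℝ (Cstar θ))) :=
    (isBounded_convexHull.2 (hcpt θ hθ).isBounded).isCompact_closure
  have heq : Set.EqOn (fun x => f x θ) (fun _ => fstar θ) (closure (convexHull ℝ (Cstar θ))) :=
    Set.EqOn.closure hconst hg continuous_const
  have hKU : closure (convexHull ℝ (Cstar θ)) ⊆ {y | |f y θ - fstar θ| < ε} := fun y hy => by
    have := heq hy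
    simp_all
  obtain ⟨r, hr, hrU⟩ := hcpt'.exists_thickening_subset_open hU hKU
  rw [Metric.thickening_closure] at hrU
  obtain ⟨δ, hδ, h⟩ := huhc r hr
  refine ⟨δ, hδ, fun θl hθl hclose lam hlam hsum x hx => hrU ?_⟩
  refine ((convex_convexHull ℝ (Cstar θ)).thickening r).sum_mem (fun l _ => hlam l) hsum
    fun l _ => ?_
  obtain ⟨z, hz, hzx⟩ := h (θl l) (hθl l) (hclose l) (hx l)
  exact Metric.mem_thickening_iff.2
    ⟨z, subset_convexHull ℝ _ hz, by rwa [dist_comm, dist_eq_norm]⟩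
end

section
/- Let Θ ⊆ ℝᵏ, let f : ℝⁿ × Θ → ℝ be continuous, let C : Θ → 2^{ℝⁿ} be a correspondence with nonempty compact values that is continuous (both upper and lower hemicontinuous) on Θ, and define f*(θ) = min_{x ∈ C(θ)} f(x, θ). For γ ≥ 0 define the suboptimal policy correspondence C^γ(θ) = {x ∈ C(θ) : |f(x, θ) − f*(θ)| ≤ γ}. Then C^γ is compact-valued and upper hemicontinuous on Θ. -/
/-- If the compact sets `S m` come arbitrarily close to `y m`, then points of `S m` can be selected
that are asymptotic to `y`. -/
theorem exists_seq_mem_tendsto_norm_sub_zero {E : Type*} [SeminormedAddCommGroup E]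
    {S : ℕ → Set E} {y : ℕ → E} (hne : ∀ m, (S m).Nonempty) (hcpt : ∀ m, IsCompact (S m))
    (hclose : ∀ ε > (0 : ℝ), ∀ᶠ m in Filter.atTop, ∃ x ∈ S m, ‖x - y m‖ < ε) :
    ∃ z : ℕ → E, (∀ m, z m ∈ S m) ∧
      Filter.Tendsto (fun m => ‖z m - y m‖) Filter.atTop (nhds 0) := by
  have hmin : ∀ m, ∃ z ∈ S m, ∀ x ∈ S m, ‖z - y m‖ ≤ ‖x - y m‖ := fun m =>
    (hcpt m).exists_isMinOn (hne m) (f := fun x => ‖x - y m‖) (by fun_prop)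
  choose z hz hzmin using hmin
  refine ⟨z, hz, Metric.tendsto_nhds.2 fun ε hε => ?_⟩
  filter_upwards [hclose ε hε] with m ⟨x, hx, hxε⟩
  simpa using (hzmin m x hx).trans_lt hxε


/-- for a continuous objective `f` and a continuous (upper and lower
hemicontinuous), nonempty compact valued feasible-region correspondence `C`, the
γ-suboptimal policy correspondence `Cγ θ = {x ∈ C θ : |f(x,θ) − f*(θ)| ≤ γ}` is
compact-valued and upper hemicontinuous on `Θ`. -/
theorem stmt_12 {k n : ℕ} (Θ : Set (EuclideanSpace ℝ (Fin k)))
    (f : EuclideanSpace ℝ (Fin n) → EuclideanSpace ℝ (Fin k) → ℝ)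
    (hf : ContinuousOn
      (fun p : EuclideanSpace ℝ (Fin n) × EuclideanSpace ℝ (Fin k) => f p.1 p.2)
      (Set.univ ×ˢ Θ))
    (C : EuclideanSpace ℝ (Fin k) → Set (EuclideanSpace ℝ (Fin n)))
    (hCne : ∀ θ ∈ Θ, (C θ).Nonempty) (hCcpt : ∀ θ ∈ Θ, IsCompact (C θ))
    (huhcC : ∀ θ₀ ∈ Θ, ∀ ε > (0:ℝ), ∃ δ > (0:ℝ), ∀ θ ∈ Θ, ‖θ - θ₀‖ < δ →
      C θ ⊆ {y | ∃ x ∈ C θ₀, ‖x - y‖ < ε})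
    (hlhcC : ∀ θ₀ ∈ Θ, ∀ ε > (0:ℝ), ∃ δ > (0:ℝ), ∀ θ ∈ Θ, ‖θ - θ₀‖ < δ →
      C θ₀ ⊆ {y | ∃ x ∈ C θ, ‖x - y‖ < ε})
    (fstar : EuclideanSpace ℝ (Fin k) → ℝ)
    (hfstar : ∀ θ ∈ Θ, IsLeast ((fun x => f x θ) '' C θ) (fstar θ))
    (γ : ℝ) (hγ : 0 ≤ γ)
    (Cγ : EuclideanSpace ℝ (Fin k) → Set (EuclideanSpace ℝ (Fin n)))
    (hCγ : ∀ θ ∈ Θ, Cγ θ = {x ∈ C θ | |f x θ - fstar θ| ≤ γ}) :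
    (∀ θ ∈ Θ, IsCompact (Cγ θ)) ∧
    (∀ θ₀ ∈ Θ, ∀ ε > (0:ℝ), ∃ δ > (0:ℝ), ∀ θ ∈ Θ, ‖θ - θ₀‖ < δ →
      Cγ θ ⊆ {y | ∃ x ∈ Cγ θ₀, ‖x - y‖ < ε}) := by
  have eq_sublevel : ∀ θ ∈ Θ, Cγ θ = {x ∈ C θ | f x θ ≤ fstar θ + γ} := by
    intro θ hθ
    rw [hCγ θ hθ]
    ext x
    refine and_congr_right fun hx => ?_
    have hle : fstar θ ≤ f x θ := (hfstar θ hθ).2 ⟨x, hx, rfl⟩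
    rw [abs_of_nonneg (sub_nonneg.2 hle), sub_le_iff_le_add']
  have tendsto_f : ∀ {u : ℕ → EuclideanSpace ℝ (Fin n)} {t : ℕ → EuclideanSpace ℝ (Fin k)} {x θ},
      θ ∈ Θ → (∀ m, t m ∈ Θ) → Filter.Tendsto u Filter.atTop (nhds x) →
      Filter.Tendsto t Filter.atTop (nhds θ) →
      Filter.Tendsto (fun m => f (u m) (t m)) Filter.atTop (nhds (f x θ)) := by
    intro u t x θ hθ ht hux htθ
    exact (hf (x, θ) ⟨trivial, hθ⟩).tendsto.comp <|
      tendsto_nhdsWithin_iff.2 ⟨hux.prodMk_nhds htθ, .of_forall fun m => ⟨trivial, ht m⟩⟩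
  refine ⟨fun θ hθ => ?_, fun θ₀ hθ₀ ε hε => ?_⟩
  · have hcont : Continuous fun x => f x θ :=
      hf.comp_continuous (by fun_prop : Continuous fun x => (x, θ)) fun x => ⟨trivial, hθ⟩
    rw [eq_sublevel θ hθ]
    exact (hCcpt θ hθ).inter_right (isClosed_le hcont continuous_const)
  · by_contra! hcon
    have hbad : ∀ m : ℕ, ∃ θ ∈ Θ, ‖θ - θ₀‖ < 1 / ((m : ℝ) + 1) ∧
        ∃ y ∈ Cγ θ, ∀ x ∈ Cγ θ₀, ε ≤ ‖x - y‖ := by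
      intro m
      obtain ⟨θ, hθ, hlt, hsub⟩ := hcon (1 / ((m : ℝ) + 1)) Nat.one_div_pos_of_nat
      obtain ⟨y, hy, hfar⟩ := Set.not_subset.1 hsub
      exact ⟨θ, hθ, hlt, y, hy, by simpa using hfar⟩
    choose t ht htlt y hy hfar using hbad
    have htlim : Filter.Tendsto t Filter.atTop (nhds θ₀) :=
      tendsto_iff_norm_sub_tendsto_zero.2 <| squeeze_zero (fun _ => norm_nonneg _)
        (fun m => (htlt m).le) tendsto_one_div_add_atTop_nhds_zero_nat
    have htnear : ∀ δ > (0 : ℝ), ∀ᶠ m in Filter.atTop, ‖t m - θ₀‖ < δ := fun δ hδ =>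
      (tendsto_iff_norm_sub_tendsto_zero.1 htlim).eventually_lt_const hδ
    have hyC : ∀ m, y m ∈ C (t m) ∧ f (y m) (t m) ≤ fstar (t m) + γ := fun m => by
      simpa [eq_sublevel _ (ht m)] using hy m
    obtain ⟨z, hz, hzy⟩ := exists_seq_mem_tendsto_norm_sub_zero (S := fun _ => C θ₀) (y := y)
      (fun _ => hCne θ₀ hθ₀) (fun _ => hCcpt θ₀ hθ₀) fun η hη => by
        obtain ⟨δ, hδ, h⟩ := huhcC θ₀ hθ₀ η hη
        filter_upwards [htnear δ hδ] with m hm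
        exact h _ (ht m) hm (hyC m).1
    obtain ⟨x₀, hx₀, hx₀min⟩ := (hfstar θ₀ hθ₀).1
    obtain ⟨w, hw, hwx₀⟩ := exists_seq_mem_tendsto_norm_sub_zero (S := fun m => C (t m))
      (y := fun _ => x₀) (fun m => hCne _ (ht m)) (fun m => hCcpt _ (ht m)) fun η hη => by
        obtain ⟨δ, hδ, h⟩ := hlhcC θ₀ hθ₀ η hη
        filter_upwards [htnear δ hδ] with m hm
        exact h _ (ht m) hm hx₀
    obtain ⟨x, hx, φ, hφ, hzx⟩ := (hCcpt θ₀ hθ₀).tendsto_subseq hz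
    have hyx : Filter.Tendsto (y ∘ φ) Filter.atTop (nhds x) := by
      simpa [Function.comp_def] using hzx.sub
        ((tendsto_zero_iff_norm_tendsto_zero.2 hzy).comp hφ.tendsto_atTop)
    have hfw := tendsto_f hθ₀ ht (tendsto_iff_norm_sub_tendsto_zero.2 hwx₀) htlim
    have hfy := tendsto_f hθ₀ (fun m => ht (φ m)) hyx (htlim.comp hφ.tendsto_atTop)
    have hle : f x θ₀ ≤ f x₀ θ₀ + γ :=
      le_of_tendsto_of_tendsto' hfy ((hfw.comp hφ.tendsto_atTop).add_const γ) fun m =>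
        (hyC (φ m)).2.trans (by
          simpa using (hfstar _ (ht (φ m))).2 ⟨w (φ m), hw (φ m), rfl⟩)
    have hxγ : x ∈ Cγ θ₀ := by
      rw [eq_sublevel θ₀ hθ₀, ← hx₀min]
      exact ⟨hx, hle⟩
    have hεle : ε ≤ ‖x - x‖ :=
      ge_of_tendsto' (hyx.const_sub x).norm fun m => hfar (φ m) x hxγ
    exact hε.not_ge (by simpa using hεle)
end

section
/- Let Θ ⊆ ℝᵏ, let f : ℝⁿ × Θ → ℝ be continuous, let C : Θ → 2^{ℝⁿ} be a continuous correspondence with nonempty compact values, define f*(θ) = min_{x ∈ C(θ)} f(x, θ), and for γ ≥ 0 let C^γ(θ) = {x ∈ C(θ) : |f(x, θ) − f*(θ)| ≤ γ}. Fix θ ∈ Θ and assume Conv(C^γ(θ)) ⊆ C(θ). Then for every ε > 0 there exists δ > 0 such that: for any points θ₁, …, θ_{k+1} ∈ Θ with ‖θ − θ_l‖ < δ for all l, any weights λ₁, …, λ_{k+1} ≥ 0 summing to 1, and any x_l ∈ C^γ(θ_l), the convex combination x̂ = λ₁x₁ + ⋯ + λ_{k+1}x_{k+1} satisfies x̂ ∈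 B_ε(C(θ)); that is, x̂ is an ε-infeasible solution. -/
open Filter Topology in
/-- The correspondence of `γ`-suboptimal solutions is upper hemicontinuous at a point where the
feasible set is compact and the feasible-set correspondence is continuous. -/
theorem exists_delta_suboptimal_near {E P : Type*} [SeminormedAddCommGroup E]
    [SeminormedAddCommGroup P] {Θ : Set P} {f : E → P → ℝ}
    (hf : ContinuousOn (fun p : E × P => f p.1 p.2) (Set.univ ×ˢ Θ))
    {C : P → Set E} {θ : P} (hθ : θ ∈ Θ) (hC : IsCompact (C θ))
    (huhc : ∀ ε > (0:ℝ), ∃ δ > (0:ℝ), ∀ θ' ∈ Θ, ‖θ' - θ‖ < δ →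
      C θ' ⊆ {y | ∃ x ∈ C θ, ‖x - y‖ < ε})
    (hlhc : ∀ ε > (0:ℝ), ∃ δ > (0:ℝ), ∀ θ' ∈ Θ, ‖θ' - θ‖ < δ →
      C θ ⊆ {y | ∃ x ∈ C θ', ‖x - y‖ < ε})
    {fstar : P → ℝ} (hfstar : ∀ θ' ∈ Θ, IsLeast ((fun x => f x θ') '' C θ') (fstar θ'))
    (γ : ℝ) {ε : ℝ} (hε : 0 < ε) :
    ∃ δ > (0:ℝ), ∀ θ' ∈ Θ, ‖θ' - θ‖ < δ → ∀ y ∈ C θ', |f y θ' - fstar θ'| ≤ γ →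
      ∃ x ∈ C θ, |f x θ - fstar θ| ≤ γ ∧ ‖x - y‖ < ε := by
  by_contra! hcon
  obtain ⟨w, hw, hwf⟩ := (hfstar θ hθ).1
  have key : ∀ m : ℕ, ∃ (t : P) (y z v : E), t ∈ Θ ∧ ‖t - θ‖ < 1 / ((m : ℝ) + 1) ∧ y ∈ C t ∧
      |f y t - fstar t| ≤ γ ∧ (∀ x ∈ C θ, |f x θ - fstar θ| ≤ γ → ε ≤ ‖x - y‖) ∧
      z ∈ C θ ∧ ‖z - y‖ < 1 / ((m : ℝ) + 1) ∧ v ∈ C t ∧ ‖v - w‖ < 1 / ((m : ℝ) + 1) := by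
    intro m
    have hm : (0:ℝ) < 1 / ((m : ℝ) + 1) := Nat.one_div_pos_of_nat
    obtain ⟨δ₁, hδ₁, h₁⟩ := huhc _ hm
    obtain ⟨δ₂, hδ₂, h₂⟩ := hlhc _ hm
    obtain ⟨t, ht, htδ, y, hy, hyγ, hfar⟩ :=
      hcon (min (1 / ((m : ℝ) + 1)) (min δ₁ δ₂)) (lt_min hm (lt_min hδ₁ hδ₂))
    simp only [lt_min_iff] at htδ
    obtain ⟨z, hz, hzy⟩ := h₁ t ht htδ.2.1 hy
    obtain ⟨v, hv, hvw⟩ := h₂ t ht htδ.2.2 hw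
    exact ⟨t, y, z, v, ht, htδ.1, hy, hyγ, hfar, hz, hzy, hv, hvw⟩
  choose t y z v ht htθ hy hyγ hfar hz hzy hv hvw using key
  have hone := tendsto_one_div_add_atTop_nhds_zero_nat (𝕜 := ℝ)
  obtain ⟨a, ha, φ, hφ, hza⟩ := hC.tendsto_subseq hz
  have hφt := hφ.tendsto_atTop
  have htlim : Tendsto (t ∘ φ) atTop (𝓝 θ) :=
    (tendsto_iff_norm_sub_tendsto_zero.2
      (squeeze_zero (fun _ => norm_nonneg _) (fun m => (htθ m).le) hone)).comp hφt
  have hvlim : Tendsto (v ∘ φ) atTop (𝓝 w) :=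
    (tendsto_iff_norm_sub_tendsto_zero.2
      (squeeze_zero (fun _ => norm_nonneg _) (fun m => (hvw m).le) hone)).comp hφt
  have hdiff : Tendsto (fun m => z m - y m) atTop (𝓝 0) :=
    squeeze_zero_norm (fun m => (hzy m).le) hone
  have hylim : Tendsto (y ∘ φ) atTop (𝓝 a) := by
    simpa [Function.comp_def] using hza.sub (hdiff.comp hφt)
  have hflim : ∀ {u : ℕ → E} {b : E}, Tendsto u atTop (𝓝 b) →
      Tendsto (fun m => f (u m) (t (φ m))) atTop (𝓝 (f b θ)) := by
    intro u b hu
    refine (hf (b, θ) ⟨trivial, hθ⟩).tendsto.comp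
      (f := fun m => (u m, t (φ m))) (tendsto_nhdsWithin_iff.2 ⟨hu.prodMk_nhds htlim, ?_⟩)
    exact Eventually.of_forall fun m => ⟨trivial, ht _⟩
  have hle : f a θ ≤ f w θ + γ := by
    refine le_of_tendsto_of_tendsto' (hflim hylim) ((hflim hvlim).add_const γ) fun m => ?_
    have h₁ := (abs_le.1 (hyγ (φ m))).2
    have h₂ : fstar (t (φ m)) ≤ f (v (φ m)) (t (φ m)) := (hfstar _ (ht _)).2 ⟨_, hv _, rfl⟩
    simp only [Function.comp_apply]
    linarith
  have haγ : |f a θ - fstar θ| ≤ γ := by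
    have h₁ : fstar θ ≤ f a θ := (hfstar θ hθ).2 ⟨a, ha, rfl⟩
    rw [abs_of_nonneg (sub_nonneg.2 h₁), ← hwf]
    simp only
    linarith
  have hlim : Tendsto (fun m => ‖a - y (φ m)‖) atTop (𝓝 ‖a - a‖) :=
    (tendsto_const_nhds.sub hylim).norm
  have := ge_of_tendsto' hlim fun m => hfar (φ m) a ha haγ
  simp only [sub_self, norm_zero] at this
  linarith


/-- in the setting of the γ-suboptimal policy correspondence
`Cγ θ = {x ∈ C θ : |f(x,θ) − f*(θ)| ≤ γ}`, if `Conv(Cγ θ) ⊆ C θ`, then for every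
`ε > 0` there is `δ > 0` such that any convex combination of γ-suboptimal points
sampled at parameters `δ`-close to `θ` lies in `B_ε(C θ)` (ε-infeasibility). -/
theorem stmt_13 {k n : ℕ} (Θ : Set (EuclideanSpace ℝ (Fin k)))
    (f : EuclideanSpace ℝ (Fin n) → EuclideanSpace ℝ (Fin k) → ℝ)
    (hf : ContinuousOn
      (fun p : EuclideanSpace ℝ (Fin n) × EuclideanSpace ℝ (Fin k) => f p.1 p.2)
      (Set.univ ×ˢ Θ))
    (C : EuclideanSpace ℝ (Fin k) → Set (EuclideanSpace ℝ (Fin n)))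
    (hCne : ∀ θ' ∈ Θ, (C θ').Nonempty) (hCcpt : ∀ θ' ∈ Θ, IsCompact (C θ'))
    (huhcC : ∀ θ₀ ∈ Θ, ∀ ε > (0:ℝ), ∃ δ > (0:ℝ), ∀ θ' ∈ Θ, ‖θ' - θ₀‖ < δ →
      C θ' ⊆ {y | ∃ x ∈ C θ₀, ‖x - y‖ < ε})
    (hlhcC : ∀ θ₀ ∈ Θ, ∀ ε > (0:ℝ), ∃ δ > (0:ℝ), ∀ θ' ∈ Θ, ‖θ' - θ₀‖ < δ →
      C θ₀ ⊆ {y | ∃ x ∈ C θ', ‖x - y‖ < ε})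
    (fstar : EuclideanSpace ℝ (Fin k) → ℝ)
    (hfstar : ∀ θ' ∈ Θ, IsLeast ((fun x => f x θ') '' C θ') (fstar θ'))
    (γ : ℝ) (hγ : 0 ≤ γ)
    (Cγ : EuclideanSpace ℝ (Fin k) → Set (EuclideanSpace ℝ (Fin n)))
    (hCγ : ∀ θ' ∈ Θ, Cγ θ' = {x ∈ C θ' | |f x θ' - fstar θ'| ≤ γ})
    (θ : EuclideanSpace ℝ (Fin k)) (hθ : θ ∈ Θ)
    (hconv : convexHull ℝ (Cγ θ) ⊆ C θ) :
    ∀ ε > (0:ℝ), ∃ δ > (0:ℝ),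
      ∀ θl : Fin (k+1) → EuclideanSpace ℝ (Fin k),
        (∀ l, θl l ∈ Θ) → (∀ l, ‖θ - θl l‖ < δ) →
      ∀ lam : Fin (k+1) → ℝ, (∀ l, 0 ≤ lam l) → (∑ l, lam l) = 1 →
      ∀ x : Fin (k+1) → EuclideanSpace ℝ (Fin n), (∀ l, x l ∈ Cγ (θl l)) →
        (∑ l, lam l • x l) ∈ {y | ∃ z ∈ C θ, ‖z - y‖ < ε} := by
  intro ε hε
  obtain ⟨δ, hδ, h⟩ := exists_delta_suboptimal_near hf hθ (hCcpt θ hθ) (huhcC θ hθ) (hlhcC θ hθ)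
    hfstar γ hε
  refine ⟨δ, hδ, fun θl hθl hclose lam hlam hsum x hx => ?_⟩
  have hnear : ∀ l, ∃ z ∈ Cγ θ, z - x l ∈ Metric.ball (0 : EuclideanSpace ℝ (Fin n)) ε := by
    intro l
    have hxl := hx l
    rw [hCγ _ (hθl l)] at hxl
    obtain ⟨z, hz, hzγ, hzx⟩ := h (θl l) (hθl l) (by rw [norm_sub_rev]; exact hclose l) (x l)
      hxl.1 hxl.2
    exact ⟨z, by rw [hCγ θ hθ]; exact ⟨hz, hzγ⟩, by simpa using hzx⟩
  choose z hz hzx using hnear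
  refine ⟨∑ l, lam l • z l, hconv ?_, ?_⟩
  · exact (convex_convexHull ℝ _).sum_mem (fun l _ => hlam l) hsum
      fun l _ => subset_convexHull ℝ _ (hz l)
  · have := (convex_ball (0 : EuclideanSpace ℝ (Fin n)) ε).sum_mem (fun l _ => hlam l) hsum
      fun l _ => hzx l
    simpa [smul_sub, Finset.sum_sub_distrib] using this
end

section
/- Let Θ ⊆ ℝᵏ, let f : ℝⁿ × Θ → ℝ be continuous, let C : Θ → 2^{ℝⁿ} be a continuous correspondence with nonempty compact values, define f*(θ) = min_{x ∈ C(θ)} f(x, θ), and for γ ≥ 0 let C^γ(θ) = {x ∈ C(θ) : |f(x, θ) − f*(θ)| ≤ γ}. Fix θ ∈ Θ and assume |f(x, θ) − f*(θ)| ≤ γ for all x ∈ Conv(C^γ(θ)). Then for every ε > 0 there exists δ > 0 such that: for any points θ₁, …, θ_{k+1} ∈ Θ with ‖θ − θ_l‖ < δ for all l, any weights λ₁, …, λ_{k+1} ≥ 0 summing to 1, and any x_l ∈ C^γ(θ_l), the convex combination x̂ = λ₁x₁ + ⋯ + λ_{k+1}x_{k+1} satisfies |f(x̂, θ) − f*(θ)|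 < ε + γ; that is, x̂ is an (ε+γ)-suboptimal solution. -/
open Filter Topology Metric

/-- Upper hemicontinuity of the `γ`-suboptimal solution correspondence of a continuous problem
whose constraint correspondence `C` is continuous at `θ` with `C θ` compact. -/
theorem exists_forall_suboptimal_mem_thickening {E P : Type*} [NormedAddCommGroup E]
    [NormedAddCommGroup P] {Θ : Set P} {f : E → P → ℝ}
    (hf : ContinuousOn (fun p : E × P => f p.1 p.2) (Set.univ ×ˢ Θ))
    {C : P → Set E} {fstar : P → ℝ}
    (hfstar : ∀ θ' ∈ Θ, IsLeast ((fun x => f x θ') '' C θ') (fstar θ'))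
    {θ : P} (hθ : θ ∈ Θ) (hC : IsCompact (C θ))
    (huhc : ∀ ε > (0:ℝ), ∃ δ > (0:ℝ), ∀ θ' ∈ Θ, ‖θ' - θ‖ < δ →
      C θ' ⊆ {y | ∃ x ∈ C θ, ‖x - y‖ < ε})
    (hlhc : ∀ ε > (0:ℝ), ∃ δ > (0:ℝ), ∀ θ' ∈ Θ, ‖θ' - θ‖ < δ →
      C θ ⊆ {y | ∃ x ∈ C θ', ‖x - y‖ < ε})
    (γ : ℝ) {η : ℝ} (hη : 0 < η) :
    ∃ δ > (0:ℝ), ∀ θ' ∈ Θ, ‖θ' - θ‖ < δ → ∀ x ∈ C θ', f x θ' ≤ fstar θ' + γ →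
      x ∈ thickening η {x ∈ C θ | f x θ ≤ fstar θ + γ} := by
  by_contra! hcon
  obtain ⟨xs, hxs, hxs_eq⟩ := (hfstar θ hθ).1
  have hseq : ∀ m : ℕ, ∃ t ∈ Θ, ‖t - θ‖ < 1 / ((m : ℝ) + 1) ∧ ∃ x ∈ C t, f x t ≤ fstar t + γ ∧
      x ∉ thickening η {x ∈ C θ | f x θ ≤ fstar θ + γ} ∧
      ∃ y ∈ C θ, ‖y - x‖ < 1 / ((m : ℝ) + 1) ∧
      ∃ z ∈ C t, ‖z - xs‖ < 1 / ((m : ℝ) + 1) := by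
    intro m
    have hm : (0:ℝ) < 1 / ((m : ℝ) + 1) := Nat.one_div_pos_of_nat
    obtain ⟨δ₁, h₁, hu⟩ := huhc _ hm
    obtain ⟨δ₂, h₂, hl⟩ := hlhc _ hm
    obtain ⟨t, ht, htd, x, hx, hxγ, hxn⟩ := hcon _ (lt_min hm (lt_min h₁ h₂))
    obtain ⟨hd, hd₁, hd₂⟩ : _ ∧ _ ∧ _ := by simpa only [lt_min_iff] using htd
    obtain ⟨y, hy, hyx⟩ := hu t ht hd₁ hx
    exact ⟨t, ht, hd, x, hx, hxγ, hxn, y, hy, hyx, hl t ht hd₂ hxs⟩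
  choose t ht htd x hx hxγ hxn y hy hyx z hz hzx using hseq
  have hlim : ∀ u : ℕ → E,
      (∀ m, ‖u m‖ < 1 / ((m : ℝ) + 1)) → Tendsto u atTop (𝓝 0) := fun u hu =>
    squeeze_zero_norm (fun m => (hu m).le) tendsto_one_div_add_atTop_nhds_zero_nat
  have hfun : ∀ {u : ℕ → E} {s : ℕ → P} {a : E}, (∀ m, s m ∈ Θ) → Tendsto u atTop (𝓝 a) →
      Tendsto s atTop (𝓝 θ) → Tendsto (fun m => f (u m) (s m)) atTop (𝓝 (f a θ)) := by
    intro u s a hs hu hsθ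
    exact (hf (a, θ) ⟨trivial, hθ⟩).tendsto.comp
      (tendsto_nhdsWithin_iff.2 ⟨hu.prodMk_nhds hsθ, .of_forall fun m => ⟨trivial, hs m⟩⟩)
  obtain ⟨a, ha, φ, hφ, hya⟩ := hC.tendsto_subseq hy
  have htθ : Tendsto t atTop (𝓝 θ) := tendsto_sub_nhds_zero_iff.1 (squeeze_zero_norm
    (fun m => (htd m).le) tendsto_one_div_add_atTop_nhds_zero_nat)
  have hzs : Tendsto z atTop (𝓝 xs) := tendsto_sub_nhds_zero_iff.1 (hlim _ hzx)
  have hxa : Tendsto (x ∘ φ) atTop (𝓝 a) := by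
    simpa [Function.comp_def] using hya.sub ((hlim _ hyx).comp hφ.tendsto_atTop)
  have htφ := htθ.comp hφ.tendsto_atTop
  have haγ : f a θ ≤ fstar θ + γ := by
    rw [← hxs_eq]
    refine le_of_tendsto_of_tendsto' (hfun (fun m => ht (φ m)) hxa htφ)
      ((hfun (fun m => ht (φ m)) (hzs.comp hφ.tendsto_atTop) htφ).add_const γ) fun m => ?_
    have := (hfstar _ (ht (φ m))).2 ⟨_, hz (φ m), rfl⟩
    exact (hxγ (φ m)).trans (by simpa using this)
  obtain ⟨m, hm⟩ := (hxa.eventually (isOpen_thickening.mem_nhds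
    (self_subset_thickening hη {x ∈ C θ | f x θ ≤ fstar θ + γ} ⟨ha, haγ⟩))).exists
  exact hxn _ hm


/-- in the setting of the γ-suboptimal policy correspondence
`Cγ θ = {x ∈ C θ : |f(x,θ) − f*(θ)| ≤ γ}`, if `|f(x,θ) − f*(θ)| ≤ γ` for all
`x ∈ Conv(Cγ θ)`, then for every `ε > 0` there is `δ > 0` such that any convex
combination of γ-suboptimal points sampled at parameters `δ`-close to `θ` is an
`(ε+γ)`-suboptimal solution. -/
theorem stmt_14 {k n : ℕ} (Θ : Set (EuclideanSpace ℝ (Fin k)))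
    (f : EuclideanSpace ℝ (Fin n) → EuclideanSpace ℝ (Fin k) → ℝ)
    (hf : ContinuousOn
      (fun p : EuclideanSpace ℝ (Fin n) × EuclideanSpace ℝ (Fin k) => f p.1 p.2)
      (Set.univ ×ˢ Θ))
    (C : EuclideanSpace ℝ (Fin k) → Set (EuclideanSpace ℝ (Fin n)))
    (hCne : ∀ θ' ∈ Θ, (C θ').Nonempty) (hCcpt : ∀ θ' ∈ Θ, IsCompact (C θ'))
    (huhcC : ∀ θ₀ ∈ Θ, ∀ ε > (0:ℝ), ∃ δ > (0:ℝ), ∀ θ' ∈ Θ, ‖θ' - θ₀‖ < δ →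
      C θ' ⊆ {y | ∃ x ∈ C θ₀, ‖x - y‖ < ε})
    (hlhcC : ∀ θ₀ ∈ Θ, ∀ ε > (0:ℝ), ∃ δ > (0:ℝ), ∀ θ' ∈ Θ, ‖θ' - θ₀‖ < δ →
      C θ₀ ⊆ {y | ∃ x ∈ C θ', ‖x - y‖ < ε})
    (fstar : EuclideanSpace ℝ (Fin k) → ℝ)
    (hfstar : ∀ θ' ∈ Θ, IsLeast ((fun x => f x θ') '' C θ') (fstar θ'))
    (γ : ℝ) (hγ : 0 ≤ γ)
    (Cγ : EuclideanSpace ℝ (Fin k) → Set (EuclideanSpace ℝ (Fin n)))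
    (hCγ : ∀ θ' ∈ Θ, Cγ θ' = {x ∈ C θ' | |f x θ' - fstar θ'| ≤ γ})
    (θ : EuclideanSpace ℝ (Fin k)) (hθ : θ ∈ Θ)
    (hsubopt : ∀ x ∈ convexHull ℝ (Cγ θ), |f x θ - fstar θ| ≤ γ) :
    ∀ ε > (0:ℝ), ∃ δ > (0:ℝ),
      ∀ θl : Fin (k+1) → EuclideanSpace ℝ (Fin k),
        (∀ l, θl l ∈ Θ) → (∀ l, ‖θ - θl l‖ < δ) →
      ∀ lam : Fin (k+1) → ℝ, (∀ l, 0 ≤ lam l) → (∑ l, lam l) = 1 →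
      ∀ x : Fin (k+1) → EuclideanSpace ℝ (Fin n), (∀ l, x l ∈ Cγ (θl l)) →
        |f (∑ l, lam l • x l) θ - fstar θ| < ε + γ := by
  intro ε hε
  have hg : Continuous fun x => f x θ := by
    rw [← continuousOn_univ]
    exact hf.comp (by fun_prop : Continuous fun x => (x, θ)).continuousOn fun x _ => ⟨trivial, hθ⟩
  have hCγ_eq : ∀ θ' ∈ Θ, Cγ θ' = {x ∈ C θ' | f x θ' ≤ fstar θ' + γ} := by
    intro θ' hθ'
    rw [hCγ θ' hθ']
    ext x
    refine and_congr_right fun hx => ?_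
    have hle : fstar θ' ≤ f x θ' := (hfstar θ' hθ').2 ⟨x, hx, rfl⟩
    rw [abs_of_nonneg (sub_nonneg.2 hle), sub_le_iff_le_add']
  have hK : IsCompact (Cγ θ) := by
    rw [hCγ_eq θ hθ]
    exact (hCcpt θ hθ).inter_right (isClosed_le hg continuous_const)
  have hgs : Continuous fun x => |f x θ - fstar θ| := (hg.sub continuous_const).abs
  have hclosure : closure (convexHull ℝ (Cγ θ)) ⊆ {x | |f x θ - fstar θ| ≤ γ} :=
    closure_minimal hsubopt (isClosed_le hgs continuous_const)
  obtain ⟨η, hη, hηsub⟩ :=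
    (isBounded_convexHull.2 hK.isBounded).isCompact_closure.exists_thickening_subset_open
      (isOpen_lt hgs continuous_const : IsOpen {x | |f x θ - fstar θ| < ε + γ})
      fun x hx => (hclosure hx).trans_lt (lt_add_of_pos_left γ hε)
  rw [thickening_closure] at hηsub
  obtain ⟨δ, hδ, hmem⟩ := exists_forall_suboptimal_mem_thickening hf hfstar hθ (hCcpt θ hθ)
    (huhcC θ hθ) (hlhcC θ hθ) γ hη
  rw [← hCγ_eq θ hθ] at hmem
  refine ⟨δ, hδ, fun θl hθl hdist lam hlam hsum x hx => hηsub ?_⟩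
  refine ((convex_convexHull ℝ (Cγ θ)).thickening η).sum_mem (fun l _ => hlam l) hsum fun l _ => ?_
  obtain ⟨hxC, hxγ⟩ := hCγ_eq _ (hθl l) ▸ hx l
  exact thickening_subset_of_subset η (subset_convexHull ℝ (Cγ θ))
    (hmem _ (hθl l) (by rw [norm_sub_rev]; exact hdist l) _ hxC hxγ)
end
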